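/- For all z₁, z₂, z₃ ∈ ℂ, the following Jacobian identities hold: (C₆, C₁₈, 𝔠₁₂) = 648·C₉·C₁₂²; (C₉, C₁₈, 𝔠₁₂) = (9/4)·C₁₂²·(C₆² − C₁₂); (C₁₂, C₁₈, 𝔠₁₂) = 0. -/

import Mathlib

noncomputable section

/-- Hessian invariant C₆. -/
def C₆ : ℂ → ℂ → ℂ → ℂ := fun z₁ z₂ z₃ =>
  z₁^6 + z₂^6 + z₃^6 - 10*(z₁^3*z₂^3 + z₂^3*z₃^3 + z₃^3*z₁^3)
/-- Hessian invariant C₉. -/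
def C₉ : ℂ → ℂ → ℂ → ℂ := fun z₁ z₂ z₃ =>
  (z₁^3 - z₂^3)*(z₂^3 - z₃^3)*(z₃^3 - z₁^3)
/-- Hessian invariant C₁₂. -/
def C₁₂ : ℂ → ℂ → ℂ → ℂ := fun z₁ z₂ z₃ =>
  (z₁^3 + z₂^3 + z₃^3)*((z₁^3 + z₂^3 + z₃^3)^3 + 216*z₁^3*z₂^3*z₃^3)
/-- Hessian invariant 𝔠₁₂. -/
def 𝔠₁₂ : ℂ → ℂ → ℂ → ℂ := fun z₁ z₂ z₃ =>
  z₁*z₂*z₃*(27*z₁^3*z₂^3*z₃^3 - (z₁^3 + z₂^3 + z₃^3)^3)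
/-- Hessian invariant C₁₈. -/
def C₁₈ : ℂ → ℂ → ℂ → ℂ := fun z₁ z₂ z₃ =>
  (z₁^3 + z₂^3 + z₃^3)^6 - 540*z₁^3*z₂^3*z₃^3*(z₁^3 + z₂^3 + z₃^3)^3 - 5832*z₁^6*z₂^6*z₃^6

/-- Complex partial derivative in the first variable. -/
def pd₁ (F : ℂ → ℂ → ℂ → ℂ) (z₁ z₂ z₃ : ℂ) : ℂ := deriv (fun t => F t z₂ z₃) z₁
/-- Complex partial derivative in the second variable. -/
def pd₂ (F : ℂ → ℂ → ℂ → ℂ) (z₁ z₂ z₃ : ℂ) : ℂ := deriv (fun t => F z₁ t z₃) z₂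
/-- Complex partial derivative in the third variable. -/
def pd₃ (F : ℂ → ℂ → ℂ → ℂ) (z₁ z₂ z₃ : ℂ) : ℂ := deriv (fun t => F z₁ z₂ t) z₃

/-- Jacobian determinant of three functions of (z₁, z₂, z₃). -/
def jac (F G H : ℂ → ℂ → ℂ → ℂ) (z₁ z₂ z₃ : ℂ) : ℂ :=
  Matrix.det !![pd₁ F z₁ z₂ z₃, pd₂ F z₁ z₂ z₃, pd₃ F z₁ z₂ z₃;
                pd₁ G z₁ z₂ z₃, pd₂ G z₁ z₂ z₃, pd₃ G z₁ z₂ z₃;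
                pd₁ H z₁ z₂ z₃, pd₂ H z₁ z₂ z₃, pd₃ H z₁ z₂ z₃]

theorem deriv_mul_left (c z : ℂ) : deriv (HMul.hMul c) z = c :=
  deriv_const_mul_id c

theorem pd₁_C₆ (z₁ z₂ z₃ : ℂ) : pd₁ C₆ z₁ z₂ z₃ =
    6*z₁^5 - 30*z₁^2*(z₂^3 + z₃^3) := by
  simp (disch := fun_prop) only [pd₁, C₆, deriv_fun_add, deriv_fun_sub, deriv_fun_mul,
    deriv_fun_pow, deriv_const, deriv_id'']
  ring

theorem pd₂_C₆ (z₁ z₂ z₃ : ℂ) : pd₂ C₆ z₁ z₂ z₃ =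
    6*z₂^5 - 30*z₂^2*(z₁^3 + z₃^3) := by
  simp (disch := fun_prop) only [pd₂, C₆, deriv_fun_add, deriv_fun_sub, deriv_fun_mul,
    deriv_fun_pow, deriv_const, deriv_id'']
  ring

theorem pd₃_C₆ (z₁ z₂ z₃ : ℂ) : pd₃ C₆ z₁ z₂ z₃ =
    6*z₃^5 - 30*z₃^2*(z₁^3 + z₂^3) := by
  simp (disch := fun_prop) only [pd₃, C₆, deriv_fun_add, deriv_fun_sub, deriv_fun_mul,
    deriv_fun_pow, deriv_const, deriv_id'']
  ring

theorem pd₁_C₉ (z₁ z₂ z₃ : ℂ) : pd₁ C₉ z₁ z₂ z₃ =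
    3*z₁^2*(z₂^3 - z₃^3)*(z₂^3 + z₃^3 - 2*z₁^3) := by
  simp (disch := fun_prop) only [pd₁, C₉, deriv_fun_sub, deriv_fun_mul,
    deriv_fun_pow, deriv_const, deriv_id'']
  ring

theorem pd₂_C₉ (z₁ z₂ z₃ : ℂ) : pd₂ C₉ z₁ z₂ z₃ =
    3*z₂^2*(z₃^3 - z₁^3)*(z₃^3 + z₁^3 - 2*z₂^3) := by
  simp (disch := fun_prop) only [pd₂, C₉, deriv_fun_sub, deriv_fun_mul,
    deriv_fun_pow, deriv_const, deriv_id'']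
  ring

theorem pd₃_C₉ (z₁ z₂ z₃ : ℂ) : pd₃ C₉ z₁ z₂ z₃ =
    3*z₃^2*(z₁^3 - z₂^3)*(z₁^3 + z₂^3 - 2*z₃^3) := by
  simp (disch := fun_prop) only [pd₃, C₉, deriv_fun_sub, deriv_fun_mul,
    deriv_fun_pow, deriv_const, deriv_id'']
  ring

theorem pd₁_C₁₂ (z₁ z₂ z₃ : ℂ) : pd₁ C₁₂ z₁ z₂ z₃ =
    12*z₁^2*((z₁^3 + z₂^3 + z₃^3)^3 + 54*z₁^3*z₂^3*z₃^3) + 648*z₁^2*z₂^3*z₃^3*(z₁^3 + z₂^3 + z₃^3) := by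
  simp (disch := fun_prop) only [pd₁, C₁₂, deriv_fun_add, deriv_fun_mul,
    deriv_fun_pow, deriv_const, deriv_id'']
  ring

theorem pd₂_C₁₂ (z₁ z₂ z₃ : ℂ) : pd₂ C₁₂ z₁ z₂ z₃ =
    12*z₂^2*((z₁^3 + z₂^3 + z₃^3)^3 + 54*z₁^3*z₂^3*z₃^3) + 648*z₂^2*z₁^3*z₃^3*(z₁^3 + z₂^3 + z₃^3) := by
  simp (disch := fun_prop) only [pd₂, C₁₂, deriv_fun_add, deriv_fun_mul,
    deriv_fun_pow, deriv_const, deriv_id'']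
  ring

theorem pd₃_C₁₂ (z₁ z₂ z₃ : ℂ) : pd₃ C₁₂ z₁ z₂ z₃ =
    12*z₃^2*((z₁^3 + z₂^3 + z₃^3)^3 + 54*z₁^3*z₂^3*z₃^3) + 648*z₃^2*z₁^3*z₂^3*(z₁^3 + z₂^3 + z₃^3) := by
  simp (disch := fun_prop) only [pd₃, C₁₂, deriv_fun_add, deriv_fun_mul,
    deriv_fun_pow, deriv_const, deriv_id'']
  ring

theorem pd₁_𝔠₁₂ (z₁ z₂ z₃ : ℂ) : pd₁ 𝔠₁₂ z₁ z₂ z₃ =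
    z₂*z₃*(108*z₁^3*z₂^3*z₃^3 - (z₁^3 + z₂^3 + z₃^3)^3) - 9*z₁^3*z₂*z₃*(z₁^3 + z₂^3 + z₃^3)^2 := by
  simp (disch := fun_prop) only [pd₁, 𝔠₁₂, deriv_fun_add, deriv_fun_sub, deriv_fun_mul,
    deriv_fun_pow, deriv_const, deriv_id'']
  ring

theorem pd₂_𝔠₁₂ (z₁ z₂ z₃ : ℂ) : pd₂ 𝔠₁₂ z₁ z₂ z₃ =
    z₁*z₃*(108*z₁^3*z₂^3*z₃^3 - (z₁^3 + z₂^3 + z₃^3)^3) - 9*z₂^3*z₁*z₃*(z₁^3 + z₂^3 + z₃^3)^2 := by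
  simp (disch := fun_prop) only [pd₂, 𝔠₁₂, deriv_fun_add, deriv_fun_sub, deriv_fun_mul,
    deriv_fun_pow, deriv_const, deriv_id'', deriv_mul_left]
  ring

theorem pd₃_𝔠₁₂ (z₁ z₂ z₃ : ℂ) : pd₃ 𝔠₁₂ z₁ z₂ z₃ =
    z₁*z₂*(108*z₁^3*z₂^3*z₃^3 - (z₁^3 + z₂^3 + z₃^3)^3) - 9*z₃^3*z₁*z₂*(z₁^3 + z₂^3 + z₃^3)^2 := by
  simp (disch := fun_prop) only [pd₃, 𝔠₁₂, deriv_fun_add, deriv_fun_sub, deriv_fun_mul,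
    deriv_fun_pow, deriv_const, deriv_id'', deriv_mul_left]
  ring

theorem pd₁_C₁₈ (z₁ z₂ z₃ : ℂ) : pd₁ C₁₈ z₁ z₂ z₃ =
    18*z₁^2*((z₁^3 + z₂^3 + z₃^3)^5 - 270*z₁^3*z₂^3*z₃^3*(z₁^3 + z₂^3 + z₃^3)^2) - 324*z₁^2*z₂^3*z₃^3*(5*(z₁^3 + z₂^3 + z₃^3)^3 + 108*z₁^3*z₂^3*z₃^3) := by
  simp (disch := fun_prop) only [pd₁, C₁₈, deriv_fun_add, deriv_fun_sub, deriv_fun_mul,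
    deriv_fun_pow, deriv_const, deriv_id'']
  ring

theorem pd₂_C₁₈ (z₁ z₂ z₃ : ℂ) : pd₂ C₁₈ z₁ z₂ z₃ =
    18*z₂^2*((z₁^3 + z₂^3 + z₃^3)^5 - 270*z₁^3*z₂^3*z₃^3*(z₁^3 + z₂^3 + z₃^3)^2) - 324*z₂^2*z₁^3*z₃^3*(5*(z₁^3 + z₂^3 + z₃^3)^3 + 108*z₁^3*z₂^3*z₃^3) := by
  simp (disch := fun_prop) only [pd₂, C₁₈, deriv_fun_add, deriv_fun_sub, deriv_fun_mul,
    deriv_fun_pow, deriv_const, deriv_id'']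
  ring

theorem pd₃_C₁₈ (z₁ z₂ z₃ : ℂ) : pd₃ C₁₈ z₁ z₂ z₃ =
    18*z₃^2*((z₁^3 + z₂^3 + z₃^3)^5 - 270*z₁^3*z₂^3*z₃^3*(z₁^3 + z₂^3 + z₃^3)^2) - 324*z₃^2*z₁^3*z₂^3*(5*(z₁^3 + z₂^3 + z₃^3)^3 + 108*z₁^3*z₂^3*z₃^3) := by
  simp (disch := fun_prop) only [pd₃, C₁₈, deriv_fun_add, deriv_fun_sub, deriv_fun_mul,
    deriv_fun_pow, deriv_const, deriv_id'']
  ring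

theorem minor₂₃_C₁₈_𝔠₁₂ (z₁ z₂ z₃ : ℂ) :
    pd₂ C₁₈ z₁ z₂ z₃ * pd₃ 𝔠₁₂ z₁ z₂ z₃ -
      pd₃ C₁₈ z₁ z₂ z₃ * pd₂ 𝔠₁₂ z₁ z₂ z₃ =
    -18 * z₁ * (z₂^3 - z₃^3) * (C₁₂ z₁ z₂ z₃)^2 := by
  rw [pd₂_C₁₈, pd₃_C₁₈, pd₂_𝔠₁₂, pd₃_𝔠₁₂, C₁₂]
  ring

theorem minor₃₁_C₁₈_𝔠₁₂ (z₁ z₂ z₃ : ℂ) :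
    pd₃ C₁₈ z₁ z₂ z₃ * pd₁ 𝔠₁₂ z₁ z₂ z₃ -
      pd₁ C₁₈ z₁ z₂ z₃ * pd₃ 𝔠₁₂ z₁ z₂ z₃ =
    -18 * z₂ * (z₃^3 - z₁^3) * (C₁₂ z₁ z₂ z₃)^2 := by
  rw [pd₃_C₁₈, pd₁_C₁₈, pd₃_𝔠₁₂, pd₁_𝔠₁₂, C₁₂]
  ring

theorem minor₁₂_C₁₈_𝔠₁₂ (z₁ z₂ z₃ : ℂ) :
    pd₁ C₁₈ z₁ z₂ z₃ * pd₂ 𝔠₁₂ z₁ z₂ z₃ -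
      pd₂ C₁₈ z₁ z₂ z₃ * pd₁ 𝔠₁₂ z₁ z₂ z₃ =
    -18 * z₃ * (z₁^3 - z₂^3) * (C₁₂ z₁ z₂ z₃)^2 := by
  rw [pd₁_C₁₈, pd₂_C₁₈, pd₁_𝔠₁₂, pd₂_𝔠₁₂, C₁₂]
  ring

theorem jac_C₁₈_𝔠₁₂ (F : ℂ → ℂ → ℂ → ℂ) (z₁ z₂ z₃ : ℂ) :
    jac F C₁₈ 𝔠₁₂ z₁ z₂ z₃ = -18 * (C₁₂ z₁ z₂ z₃)^2 *
      (pd₁ F z₁ z₂ z₃ * z₁ * (z₂^3 - z₃^3) + pd₂ F z₁ z₂ z₃ * z₂ * (z₃^3 - z₁^3) +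
        pd₃ F z₁ z₂ z₃ * z₃ * (z₁^3 - z₂^3)) := by
  rw [jac, Matrix.det_fin_three]
  simp only [Matrix.of_apply, Matrix.cons_val]
  linear_combination pd₁ F z₁ z₂ z₃ * minor₂₃_C₁₈_𝔠₁₂ z₁ z₂ z₃ +
    pd₂ F z₁ z₂ z₃ * minor₃₁_C₁₈_𝔠₁₂ z₁ z₂ z₃ + pd₃ F z₁ z₂ z₃ * minor₁₂_C₁₈_𝔠₁₂ z₁ z₂ z₃

theorem jacobian_identities_III (z₁ z₂ z₃ : ℂ) :
    jac C₆ C₁₈ 𝔠₁₂ z₁ z₂ z₃ = 648 * C₉ z₁ z₂ z₃ * (C₁₂ z₁ z₂ z₃)^2 ∧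
    jac C₉ C₁₈ 𝔠₁₂ z₁ z₂ z₃
      = (9/4) * (C₁₂ z₁ z₂ z₃)^2 * ((C₆ z₁ z₂ z₃)^2 - C₁₂ z₁ z₂ z₃) ∧
    jac C₁₂ C₁₈ 𝔠₁₂ z₁ z₂ z₃ = 0 := by
  refine ⟨?_, ?_, ?_⟩
  · rw [jac_C₁₈_𝔠₁₂, pd₁_C₆, pd₂_C₆, pd₃_C₆, C₉]
    ring
  · have h : -18 * (pd₁ C₉ z₁ z₂ z₃ * z₁ * (z₂^3 - z₃^3) +
        pd₂ C₉ z₁ z₂ z₃ * z₂ * (z₃^3 - z₁^3) + pd₃ C₉ z₁ z₂ z₃ * z₃ * (z₁^3 - z₂^3)) =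
        (9/4) * ((C₆ z₁ z₂ z₃)^2 - C₁₂ z₁ z₂ z₃) := by
      rw [pd₁_C₉, pd₂_C₉, pd₃_C₉, C₆, C₁₂]
      ring
    rw [jac_C₁₈_𝔠₁₂]
    linear_combination (C₁₂ z₁ z₂ z₃)^2 * h
  · rw [jac_C₁₈_𝔠₁₂, pd₁_C₁₂, pd₂_C₁₂, pd₃_C₁₂]
    ring
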